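/- For every λ > 0, the map (a,b) ↦ T_λ(a,b) sending a pair of marginals to the unique minimizer of T ↦ ⟨T,M⟩ - h(T)/λ over Π(a,b) is infinitely differentiable (C^∞) on the interior of Δ_n × Δ_m. -/

import Mathlib

open scoped BigOperators

noncomputable section

/-- The transportation polytope `Π(a,b)`: `n × m` matrices with nonnegative entries,
row sums `a` and column sums `b`. -/
def transportPolytope {n m : ℕ} (a : Fin n → ℝ) (b : Fin m → ℝ) :
    Set (Matrix (Fin n) (Fin m) ℝ) :=
  {T | (∀ i j, 0 ≤ T i j) ∧ (∀ i, ∑ j, T i j = a i) ∧ (∀ j, ∑ i, T i j = b j)}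

/-- Frobenius inner product `⟨T, M⟩ = Tr(Tᵀ M)`. -/
def frob {n m : ℕ} (T M : Matrix (Fin n) (Fin m) ℝ) : ℝ :=
  ∑ i, ∑ j, T i j * M i j

/-- Entropy `h(T) = -∑ T_ij (log T_ij - 1)`, with the convention `0 log 0 = 0`
(automatic since `Real.log 0 = 0`). -/
def ent {n m : ℕ} (T : Matrix (Fin n) (Fin m) ℝ) : ℝ :=
  -∑ i, ∑ j, T i j * (Real.log (T i j) - 1)


/-- The interior of `Δ_n × Δ_m`: pairs of strictly positive vectors summing to one. -/
def intSimplexPairs (n m : ℕ) : Set ((Fin n → ℝ) × (Fin m → ℝ)) :=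
  {p | (∀ i, 0 < p.1 i) ∧ (∑ i, p.1 i = 1) ∧ (∀ j, 0 < p.2 j) ∧ (∑ j, p.2 j = 1)}

open Filter Topology

/-- The linear cost `c` penalised by the negative entropy, on vectors indexed by `ι`. -/
def entropicCost {ι : Type*} [Fintype ι] (c : ι → ℝ) (lam : ℝ) (T : ι → ℝ) : ℝ :=
  ∑ k, (T k * c k + T k * (Real.log (T k) - 1) / lam)

/-- Scalar Bregman inequality for `x ↦ x (log x - 1)`, with its equality case. -/
theorem mul_log_sub_one_bregman {s t : ℝ} (hs : 0 < s) (ht : 0 ≤ t) :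
    0 ≤ t * (Real.log t - 1) - s * (Real.log s - 1) - Real.log s * (t - s) ∧
    (t * (Real.log t - 1) - s * (Real.log s - 1) - Real.log s * (t - s) = 0 → t = s) := by
  have key : t * (Real.log t - 1) - s * (Real.log s - 1) - Real.log s * (t - s)
      = s * InformationTheory.klFun (t / s) := by
    rw [InformationTheory.klFun_apply]
    rcases ht.eq_or_lt with rfl | ht'
    · simp; ring
    · rw [Real.log_div ht'.ne' hs.ne']
      field_simp
      ring
  have hts : 0 ≤ t / s := div_nonneg ht hs.le
  rw [key]
  refine ⟨mul_nonneg hs.le (InformationTheory.klFun_nonneg hts), fun h => ?_⟩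
  have h1 := (InformationTheory.klFun_eq_zero_iff hts).1 ((mul_eq_zero.1 h).resolve_left hs.ne')
  rwa [div_eq_one_iff_eq hs.ne'] at h1

/-- A positive critical point of the entropic cost along `T - S` is its strict minimiser. -/
theorem eq_of_entropicCost_le {ι : Type*} [Fintype ι] {c : ι → ℝ} {lam : ℝ} (hlam : 0 < lam)
    {S T : ι → ℝ} (hS : ∀ k, 0 < S k) (hT : ∀ k, 0 ≤ T k)
    (hcrit : ∑ k, (c k + Real.log (S k) / lam) * (T k - S k) = 0)
    (hle : entropicCost c lam T ≤ entropicCost c lam S) : T = S := by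
  set B : ι → ℝ := fun k =>
    T k * (Real.log (T k) - 1) - S k * (Real.log (S k) - 1) - Real.log (S k) * (T k - S k)
    with hB
  have hB0 : ∀ k, 0 ≤ B k := fun k => (mul_log_sub_one_bregman (hS k) (hT k)).1
  have hsum : (∑ k, B k) / lam = entropicCost c lam T - entropicCost c lam S
      - ∑ k, (c k + Real.log (S k) / lam) * (T k - S k) := by
    simp only [entropicCost, ← Finset.sum_sub_distrib, Finset.sum_div, hB]
    refine Finset.sum_congr rfl fun k _ => ?_
    field_simp
    ring
  have hle0 : ∑ k, B k ≤ 0 := by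
    have : (∑ k, B k) / lam ≤ 0 := by rw [hsum, hcrit]; linarith
    by_contra! h
    exact absurd this (not_le.2 (div_pos h hlam))
  have hz : ∑ k, B k = 0 := le_antisymm hle0 (Finset.sum_nonneg fun k _ => hB0 k)
  funext k
  exact (mul_log_sub_one_bregman (hS k) (hT k)).2
    ((Finset.sum_eq_zero_iff_of_nonneg fun k _ => hB0 k).1 hz k (Finset.mem_univ k))

/-- The slope of the entropy is infinite at the boundary of the orthant, so minimisers along
segments towards a positive vector are positive. -/
theorem pos_of_entropicCost_le_segment {ι : Type*} [Fintype ι] {c : ι → ℝ} {lam : ℝ}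
    (hlam : 0 < lam) {T R : ι → ℝ} (hT : ∀ k, 0 ≤ T k) (hR : ∀ k, 0 < R k)
    (hmin : ∀ t : ℝ, 0 < t → t ≤ 1 →
      entropicCost c lam T ≤ entropicCost c lam (fun k => (1 - t) * T k + t * R k)) :
    ∀ k, 0 < T k := by
  classical
  intro k₀
  by_contra hk₀
  have hk₀ : T k₀ = 0 := le_antisymm (not_lt.1 hk₀) (hT k₀)
  set φ : ι → ℝ → ℝ := fun k x => x * c k + x * (Real.log x - 1) / lam with hφ
  have hconv : ∀ k (t : ℝ), 0 < t → t ≤ 1 →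
      φ k ((1 - t) * T k + t * R k) ≤ (1 - t) * φ k (T k) + t * φ k (R k) := by
    intro k t ht ht1
    have h := Real.convexOn_mul_log.2 (hT k) (hR k).le (sub_nonneg.2 ht1) ht.le (by ring)
    simp only [smul_eq_mul] at h
    have h2 := div_le_div_of_nonneg_right h hlam.le
    have e : ∀ x, φ k x = x * c k - x / lam + x * Real.log x / lam := fun x => by
      simp only [hφ]; ring
    rw [e, e, e]
    refine (add_le_add_right h2 _).trans (le_of_eq ?_)
    ring
  have hbdry : ∀ t : ℝ, 0 < t →
      φ k₀ ((1 - t) * T k₀ + t * R k₀)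
        = (1 - t) * φ k₀ (T k₀) + t * φ k₀ (R k₀) + t * R k₀ * Real.log t / lam := by
    intro t ht
    simp only [hφ, hk₀, mul_zero, zero_add, zero_mul, zero_div,
      Real.log_mul ht.ne' (hR k₀).ne']
    ring
  set C := ∑ k, φ k (R k) - ∑ k, φ k (T k) with hC
  have hineq : ∀ t : ℝ, 0 < t → t ≤ 1 → 0 ≤ C + R k₀ * Real.log t / lam := by
    intro t ht ht1
    have h : ∑ k, φ k ((1 - t) * T k + t * R k) ≤
        ∑ k, ((1 - t) * φ k (T k) + t * φ k (R k)
          + if k = k₀ then t * R k₀ * Real.log t / lam else 0) := by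
      refine Finset.sum_le_sum fun k _ => ?_
      split_ifs with hk
      · subst hk; exact (hbdry t ht).le
      · simpa using hconv k t ht ht1
    have hs : ∑ k, ((1 - t) * φ k (T k) + t * φ k (R k))
        = (1 - t) * ∑ k, φ k (T k) + t * ∑ k, φ k (R k) := by
      rw [Finset.sum_add_distrib, Finset.mul_sum, Finset.mul_sum]
    rw [Finset.sum_add_distrib (f := fun k => (1 - t) * φ k (T k) + t * φ k (R k)), hs,
      Finset.sum_ite_eq' Finset.univ k₀, if_pos (Finset.mem_univ _)] at h
    have h' := (hmin t ht ht1).trans h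
    change ∑ k, φ k (T k) ≤ _ at h'
    have : 0 ≤ t * (C + R k₀ * Real.log t / lam) := by
      rw [hC]; linear_combination h'
    exact nonneg_of_mul_nonneg_right this ht
  have hx : 0 ≤ (|C| + 1) * lam / R k₀ := by have := hR k₀; positivity
  have h := hineq (Real.exp (-((|C| + 1) * lam / R k₀))) (Real.exp_pos _)
    (Real.exp_le_one_iff.2 (neg_nonpos.2 hx))
  rw [Real.log_exp] at h
  have e : R k₀ * -((|C| + 1) * lam / R k₀) / lam = -(|C| + 1) := by
    have := (hR k₀).ne'
    field_simp
  rw [e] at h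
  linarith [le_abs_self C]

/-- First-order condition for the entropic cost at a positive local minimiser along a line. -/
theorem entropicCost_critical {ι : Type*} [Fintype ι] {c : ι → ℝ} {lam : ℝ}
    {T H : ι → ℝ} (hT : ∀ k, 0 < T k)
    (hmin : ∀ᶠ t : ℝ in 𝓝 0, entropicCost c lam T ≤ entropicCost c lam (fun k => T k + t * H k)) :
    ∑ k, (c k + Real.log (T k) / lam) * H k = 0 := by
  have hd : HasDerivAt (fun t : ℝ => entropicCost c lam (fun k => T k + t * H k))
      (∑ k, (c k + Real.log (T k) / lam) * H k) 0 := by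
    unfold entropicCost
    refine HasDerivAt.fun_sum fun k _ => ?_
    have h1 : HasDerivAt (fun t : ℝ => T k + t * H k) (H k) 0 := by
      simpa using ((hasDerivAt_id (0 : ℝ)).mul_const (H k)).const_add (T k)
    have hne : T k + 0 * H k ≠ 0 := by simpa using (hT k).ne'
    have h2 := (h1.mul_const (c k)).add ((h1.mul ((h1.log hne).sub_const 1)).div_const lam)
    refine h2.congr_deriv ?_
    have := (hT k).ne'
    simp only [zero_mul, add_zero]
    field_simp
    ring
  refine IsLocalMin.hasDerivAt_eq_zero (f := fun t : ℝ =>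
    entropicCost c lam (fun k => T k + t * H k)) ?_ hd
  filter_upwards [hmin] with t ht
  simpa using ht

/-- The pairings of a vector with the elements of a basis of a subspace `K` of `ι → ℝ`. -/
def dotBasis {ι : Type*} [Fintype ι] (K : Submodule ℝ (ι → ℝ)) :
    (ι → ℝ) →L[ℝ] (Fin (Module.finrank ℝ K) → ℝ) :=
  LinearMap.toContinuousLinearMap (LinearMap.pi fun l =>
    ∑ k, ((Module.finBasis ℝ K l : K) : ι → ℝ) k • LinearMap.proj k)

theorem dotBasis_eq_zero_iff {ι : Type*} [Fintype ι] {K : Submodule ℝ (ι → ℝ)} {v : ι → ℝ} :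
    dotBasis K v = 0 ↔ ∀ H ∈ K, ∑ k, v k * H k = 0 := by
  have hval : ∀ l, dotBasis K v l = ∑ k, v k * ((Module.finBasis ℝ K l : K) : ι → ℝ) k := by
    intro l
    simp [dotBasis, mul_comm]
  refine ⟨fun h H hH => ?_, fun h => funext fun l => (hval l).trans (h _ (Subtype.prop _))⟩
  let φ : K →ₗ[ℝ] ℝ := (∑ k, v k • LinearMap.proj (R := ℝ) (φ := fun _ : ι => ℝ) k) ∘ₗ K.subtype
  have hφ : ∀ H : K, φ H = ∑ k, v k * (H : ι → ℝ) k := fun H => by simp [φ]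
  have h0 : φ = 0 := (Module.finBasis ℝ K).ext fun l => by
    rw [hφ, ← hval, h]
    rfl
  rw [← hφ ⟨H, hH⟩, h0, LinearMap.zero_apply]

/-- The derivative of the optimality system, `H ↦ (A H, ⟨w H, ·⟩)`, is invertible. -/
theorem exists_equiv_optimality_deriv {ι W : Type*} [Fintype ι] [NormedAddCommGroup W]
    [NormedSpace ℝ W] (A : (ι → ℝ) →L[ℝ] W) (w : ι → ℝ)
    (hw : ∀ k, 0 < w k) (L : (ι → ℝ) →L[ℝ] (ι → ℝ)) (hL : ∀ H k, L H k = w k * H k) :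
    ∃ e : (ι → ℝ) ≃L[ℝ] (A.range × (Fin (Module.finrank ℝ A.ker) → ℝ)),
      (e : (ι → ℝ) →L[ℝ] (A.range × (Fin (Module.finrank ℝ A.ker) → ℝ))) =
        A.rangeRestrict.prod ((dotBasis A.ker).comp L) := by
  set Ψ := A.rangeRestrict.prod ((dotBasis A.ker).comp L)
  have hinj : Function.Injective Ψ := by
    rw [injective_iff_map_eq_zero]
    intro H hH
    have h1 : A H = 0 := congrArg (fun q => (q.1 : W)) hH
    have h2 : ∑ k, L H k * H k = 0 := dotBasis_eq_zero_iff.1 (congrArg Prod.snd hH) H h1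
    simp only [hL] at h2
    have hnn : ∀ k ∈ Finset.univ, 0 ≤ w k * H k * H k := fun k _ => by
      rw [mul_assoc]; exact mul_nonneg (hw k).le (mul_self_nonneg _)
    funext k
    have := (Finset.sum_eq_zero_iff_of_nonneg hnn).1 h2 k (Finset.mem_univ k)
    simpa [mul_assoc, (hw k).ne'] using this
  have hdim : Module.finrank ℝ (ι → ℝ) = Module.finrank ℝ (A.range × (Fin (Module.finrank ℝ A.ker) → ℝ)) := by
    rw [Module.finrank_prod, Module.finrank_fin_fun]
    exact (LinearMap.finrank_range_add_finrank_ker (A : (ι → ℝ) →ₗ[ℝ] W)).symm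
  refine ⟨(LinearMap.linearEquivOfInjective (Ψ : (ι → ℝ) →ₗ[ℝ] _) hinj
    hdim).toContinuousLinearEquiv, ?_⟩
  ext1 H
  rfl

/-- Near a positive solution, the optimality system of the entropic problem with linear
constraint `A T = p` has positive solutions that depend smoothly on `p`. -/
theorem exists_contDiffAt_critical {ι W : Type*} [Fintype ι] [NormedAddCommGroup W]
    [NormedSpace ℝ W] [FiniteDimensional ℝ W] (A : (ι → ℝ) →L[ℝ] W) (c : ι → ℝ) {lam : ℝ}
    (hlam : 0 < lam) (T₀ : ι → ℝ) (hT₀ : ∀ k, 0 < T₀ k)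
    (hcrit : ∀ H, A H = 0 → ∑ k, (c k + Real.log (T₀ k) / lam) * H k = 0) :
    ∃ G : W → ι → ℝ, ContDiffAt ℝ (⊤ : ℕ∞) G (A T₀) ∧
      ∀ᶠ p in 𝓝 (A T₀), p ∈ A.range → (∀ k, 0 < G p k) ∧ A (G p) = p ∧
        ∀ H, A H = 0 → ∑ k, (c k + Real.log (G p k) / lam) * H k = 0 := by
  set g : (ι → ℝ) → (ι → ℝ) := fun T k => c k + Real.log (T k) / lam with hg
  set Φ : (ι → ℝ) → A.range × (Fin (Module.finrank ℝ A.ker) → ℝ) :=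
    fun T => (A.rangeRestrict T, dotBasis A.ker (g T))
  have hgsm : ContDiffAt ℝ (⊤ : ℕ∞) g T₀ := by
    rw [contDiffAt_pi]
    intro k
    exact contDiffAt_const.add
      (((contDiffAt_apply ℝ ℝ k T₀).log (hT₀ k).ne').div_const lam)
  let L : (ι → ℝ) →L[ℝ] (ι → ℝ) := ContinuousLinearMap.pi fun k =>
    ((T₀ k)⁻¹ / lam) • ContinuousLinearMap.proj (R := ℝ) (φ := fun _ : ι => ℝ) k
  have hgd : HasFDerivAt g L T₀ := by
    rw [hasFDerivAt_pi']
    intro k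
    have h := (((hasFDerivAt_apply (𝕜 := ℝ) k T₀).log (hT₀ k).ne').mul_const lam⁻¹).const_add (c k)
    simp only [← div_eq_mul_inv] at h
    refine h.congr_fderiv ?_
    ext H
    simp [L]
    ring
  obtain ⟨e, he⟩ := exists_equiv_optimality_deriv A (fun k => (T₀ k)⁻¹ / lam)
    (fun k => div_pos (inv_pos.2 (hT₀ k)) hlam) L (fun H k => by simp [L])
  have hΦsm : ContDiffAt ℝ (⊤ : ℕ∞) Φ T₀ :=
    A.rangeRestrict.contDiff.contDiffAt.prodMk ((dotBasis A.ker).contDiff.contDiffAt.comp T₀ hgsm)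
  have hΦd : HasFDerivAt Φ (e : (ι → ℝ) →L[ℝ] (A.range × (Fin (Module.finrank ℝ A.ker) → ℝ))) T₀ := by
    rw [he]
    exact A.rangeRestrict.hasFDerivAt.prodMk ((dotBasis A.ker).hasFDerivAt.comp T₀ hgd)
  have htop : ((⊤ : ℕ∞) : WithTop ℕ∞) ≠ 0 := by simp
  obtain ⟨π, hπ⟩ := LinearMap.exists_leftInverse_of_injective A.range.subtype
    (Submodule.ker_subtype _)
  have hπ' : ∀ q : A.range, π q = q := fun q => LinearMap.congr_fun hπ q
  let ψ : W → A.range × (Fin (Module.finrank ℝ A.ker) → ℝ) := fun p => (LinearMap.toContinuousLinearMap π p, 0)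
  have hψ : ContDiff ℝ (⊤ : ℕ∞) ψ :=
    (LinearMap.toContinuousLinearMap π).contDiff.prodMk contDiff_const
  have hψ0 : ψ (A T₀) = Φ T₀ := by
    refine Prod.ext (hπ' ⟨A T₀, T₀, rfl⟩) ?_
    exact (dotBasis_eq_zero_iff.2 hcrit).symm
  have hinv := (hΦsm.hasStrictFDerivAt' hΦd htop)
  have hsm := hΦsm.to_localInverse hΦd htop
  rw [← hψ0] at hsm
  refine ⟨fun p => hΦsm.localInverse hΦd htop (ψ p), hsm.comp (A T₀) hψ.contDiffAt, ?_⟩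
  have hψt : Tendsto ψ (𝓝 (A T₀)) (𝓝 (Φ T₀)) := hψ0 ▸ hψ.continuous.tendsto (A T₀)
  have hpos : ∀ᶠ T in 𝓝 T₀, ∀ k, 0 < T k :=
    eventually_all.2 fun k => (continuous_apply k).continuousAt.eventually (lt_mem_nhds (hT₀ k))
  filter_upwards [hψt.eventually hinv.eventually_right_inverse,
    hψt.eventually (hinv.localInverse_tendsto.eventually hpos)] with p hp1 hp2 hpr
  refine ⟨hp2, ?_, fun H hH => ?_⟩
  · have h := congrArg (fun q => (q.1 : W)) hp1
    exact h.trans (congrArg Subtype.val (hπ' ⟨p, hpr⟩))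
  · exact dotBasis_eq_zero_iff.1 (congrArg Prod.snd hp1) H hH

/-- The pair of marginals of a matrix, as a linear map on `Fin n × Fin m → ℝ`. -/
def marginals (n m : ℕ) : (Fin n × Fin m → ℝ) →L[ℝ] (Fin n → ℝ) × (Fin m → ℝ) :=
  LinearMap.toContinuousLinearMap
    { toFun := fun T => (fun i => ∑ j, T (i, j), fun j => ∑ i, T (i, j))
      map_add' := fun S T => by
        ext <;> simp [Finset.sum_add_distrib]
      map_smul' := fun r T => by
        ext <;> simp [Finset.mul_sum] }

theorem marginals_apply {n m : ℕ} (T : Fin n × Fin m → ℝ) :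
    marginals n m T = (fun i => ∑ j, T (i, j), fun j => ∑ i, T (i, j)) := rfl

theorem mem_transportPolytope_iff {n m : ℕ} {p : (Fin n → ℝ) × (Fin m → ℝ)}
    {T : Fin n × Fin m → ℝ} :
    Function.curry T ∈ transportPolytope p.1 p.2 ↔ (∀ k, 0 ≤ T k) ∧ marginals n m T = p := by
  rw [marginals_apply, Prod.ext_iff, funext_iff, funext_iff]
  simp only [Prod.forall]
  rfl

theorem frob_sub_ent_div {n m : ℕ} (M : Matrix (Fin n) (Fin m) ℝ) (lam : ℝ)
    (T : Fin n × Fin m → ℝ) :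
    frob (Function.curry T) M - ent (Function.curry T) / lam
      = entropicCost (Function.uncurry M) lam T := by
  simp only [frob, ent, entropicCost, Fintype.sum_prod_type, Finset.sum_add_distrib,
    Finset.sum_div, neg_div, sub_neg_eq_add]
  rfl

/-- for every `λ > 0`, the map `(a,b) ↦ T_λ(a,b)` sending marginals to the
unique minimizer of `T ↦ ⟨T,M⟩ - h(T)/λ` over `Π(a,b)` (given by a selection `Tsel`) is
`C^∞` on the interior of `Δ_n × Δ_m` (entrywise, along the affine subspace). -/
theorem statement7 {n m : ℕ} (hn : 1 ≤ n) (hm : 1 ≤ m)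
    (M : Matrix (Fin n) (Fin m) ℝ) (lam : ℝ) (hlam : 0 < lam)
    (Tsel : (Fin n → ℝ) → (Fin m → ℝ) → Matrix (Fin n) (Fin m) ℝ)
    (hTsel : ∀ p ∈ intSimplexPairs n m,
      Tsel p.1 p.2 ∈ transportPolytope p.1 p.2 ∧
      IsMinOn (fun T => frob T M - ent T / lam) (transportPolytope p.1 p.2) (Tsel p.1 p.2)) :
    ∀ i j, ContDiffOn ℝ (⊤ : ℕ∞)
      (fun p : (Fin n → ℝ) × (Fin m → ℝ) => Tsel p.1 p.2 i j)
      (intSimplexPairs n m) := by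
  set A := marginals n m
  set c := Function.uncurry M
  set τ : (Fin n → ℝ) × (Fin m → ℝ) → Fin n × Fin m → ℝ :=
    fun p => Function.uncurry (Tsel p.1 p.2) with hτ
  have hτmem : ∀ p ∈ intSimplexPairs n m, (∀ k, 0 ≤ τ p k) ∧ A (τ p) = p := fun p hp =>
    mem_transportPolytope_iff.1 (hTsel p hp).1
  have hτmin : ∀ p ∈ intSimplexPairs n m, ∀ S, (∀ k, 0 ≤ S k) → A S = p →
      entropicCost c lam (τ p) ≤ entropicCost c lam S := by
    intro p hp S hS hAS
    have h := isMinOn_iff.1 (hTsel p hp).2 (Function.curry S)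
      (mem_transportPolytope_iff.2 ⟨hS, hAS⟩)
    rw [frob_sub_ent_div] at h
    rw [← frob_sub_ent_div]
    exact h
  intro i j p₀ hp₀
  have hpos : ∀ k, 0 < τ p₀ k := by
    obtain ⟨ha, hsa, hb, hsb⟩ := id hp₀
    refine pos_of_entropicCost_le_segment (c := c) hlam (R := fun k => p₀.1 k.1 * p₀.2 k.2)
      (hτmem p₀ hp₀).1 (fun k => mul_pos (ha _) (hb _)) fun t ht ht1 => ?_
    refine hτmin p₀ hp₀ _ (fun k => add_nonneg
      (mul_nonneg (sub_nonneg.2 ht1) ((hτmem p₀ hp₀).1 k))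
      (mul_pos ht (mul_pos (ha _) (hb _))).le) ?_
    have hR : A (fun k => p₀.1 k.1 * p₀.2 k.2) = p₀ := by
      rw [marginals_apply]
      ext <;> simp [← Finset.mul_sum, ← Finset.sum_mul, hsa, hsb]
    have : (fun k => (1 - t) * τ p₀ k + t * (p₀.1 k.1 * p₀.2 k.2))
        = (1 - t) • τ p₀ + t • fun k : Fin n × Fin m => p₀.1 k.1 * p₀.2 k.2 := rfl
    rw [this, map_add, map_smul, map_smul, hR, (hτmem p₀ hp₀).2, ← add_smul, sub_add_cancel,
      one_smul]
  have hcrit : ∀ H, A H = 0 → ∑ k, (c k + Real.log (τ p₀ k) / lam) * H k = 0 := by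
    intro H hH
    refine entropicCost_critical hpos ?_
    have hev : ∀ᶠ t : ℝ in 𝓝 0, ∀ k, 0 < τ p₀ k + t * H k := by
      refine eventually_all.2 fun k => ?_
      have hc : ContinuousAt (fun t : ℝ => τ p₀ k + t * H k) 0 := by fun_prop
      exact hc.eventually (lt_mem_nhds (by simpa using hpos k))
    filter_upwards [hev] with t ht
    refine hτmin p₀ hp₀ _ (fun k => (ht k).le) ?_
    have : (fun k => τ p₀ k + t * H k) = τ p₀ + t • H := rfl
    rw [this, map_add, map_smul, hH, smul_zero, add_zero, (hτmem p₀ hp₀).2]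
  obtain ⟨G, hGsm, hG⟩ := exists_contDiffAt_critical A c hlam (τ p₀) hpos hcrit
  rw [(hτmem p₀ hp₀).2] at hGsm hG
  have heq : ∀ᶠ p in 𝓝[intSimplexPairs n m] p₀, τ p = G p := by
    filter_upwards [nhdsWithin_le_nhds hG, self_mem_nhdsWithin] with p hGp hp
    obtain ⟨hGpos, hAG, hGcrit⟩ := hGp ⟨τ p, (hτmem p hp).2⟩
    refine eq_of_entropicCost_le (c := c) hlam hGpos (hτmem p hp).1 (hGcrit (τ p - G p) ?_)
      (hτmin p hp _ (fun k => (hGpos k).le) hAG)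
    rw [map_sub, hAG, (hτmem p hp).2, sub_self]
  have hGij : ContDiffWithinAt ℝ (⊤ : ℕ∞) (fun p => G p (i, j)) (intSimplexPairs n m) p₀ :=
    (contDiffAt_pi.1 hGsm (i, j)).contDiffWithinAt
  refine hGij.congr_of_eventuallyEq_of_mem ?_ hp₀
  filter_upwards [heq] with p hp
  exact congrFun hp (i, j)
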